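/- Let n ≥ 1 and let ⪯ be a tree poset on Fin n. Then the n vectors consisting of v_{a→b} for the n−1 covering relations a ⋖ b of ⪯, together with the all-ones vector e, form a ℤ-basis of the lattice ℤ^n ⊆ ℝ^n (equivalently, every vector of ℤ^n is an integer linear combination of these n vectors, and they are linearly independent over ℝ). In particular the cone σ_⪯ is a smooth (unimodular) cone relative to the line ℝ·e. -/

import Mathlib

noncomputable section

/-- The 0/1 indicator vector of a subset `S ⊆ Fin n`, as an element of `ℝ^n`. -/
def indVec {n : ℕ} (S : Set (Fin n)) : Fin n → ℝ := S.indicator fun _ => 1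

/-- The all-ones vector `e ∈ ℝ^n`. -/
def allOnes (n : ℕ) : Fin n → ℝ := fun _ => 1

/-- The cone `σ_⪯ = {x ∈ ℝ^n : x_a ≤ x_b whenever a ⪯ b}` of a relation. -/
def sigmaCone {n : ℕ} (r : Fin n → Fin n → Prop) : Set (Fin n → ℝ) :=
  {x | ∀ a b, r a b → x a ≤ x b}

/-- `b` covers `a` in the relation `r`: `a ⋖ b`. -/
def CoversRel {n : ℕ} (r : Fin n → Fin n → Prop) (a b : Fin n) : Prop :=
  r a b ∧ a ≠ b ∧ ∀ c, r a c → r c b → c = a ∨ c = b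

/-- The Hasse diagram of a partial order on `Fin n`, as an undirected simple graph:
an edge `{a, b}` for each covering relation `a ⋖ b`. -/
def hasseGraph {n : ℕ} (r : Fin n → Fin n → Prop) : SimpleGraph (Fin n) where
  Adj a b := CoversRel r a b ∨ CoversRel r b a
  symm := ⟨fun a b h => h.symm⟩
  loopless := ⟨fun a h => by rcases h with h | h <;> exact h.2.1 rfl⟩

/-- `r` is a tree poset: a partial order whose Hasse diagram is a tree. -/
def IsTreePoset {n : ℕ} (r : Fin n → Fin n → Prop) : Prop :=
  (∀ a, r a a) ∧ (∀ a b c, r a b → r b c → r a c) ∧ (∀ a b, r a b → r b a → a = b) ∧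
    (hasseGraph r).IsTree

/-- `B(a,b)`: the vertex set of the connected component of `b` in the Hasse diagram
after deleting the edge `{a, b}`. -/
def compB {n : ℕ} (r : Fin n → Fin n → Prop) (a b : Fin n) : Set (Fin n) :=
  {x | ((hasseGraph r).deleteEdges {s(a, b)}).Reachable b x}

/-- The ray generator `v_{a→b} = e_{B(a,b)}`. -/
def rayVec {n : ℕ} (r : Fin n → Fin n → Prop) (a b : Fin n) : Fin n → ℝ :=
  indVec (compB r a b)

/-- `cone(V)`: the set of finite nonnegative linear combinations of elements of `V`. -/
def coneOf {n : ℕ} (V : Set (Fin n → ℝ)) : Set (Fin n → ℝ) :=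
  {x | ∃ (s : Finset (Fin n → ℝ)) (c : (Fin n → ℝ) → ℝ),
    ↑s ⊆ V ∧ (∀ v ∈ s, 0 ≤ c v) ∧ x = ∑ v ∈ s, c v • v}

/-- `cone(V) + ℝ·e`. -/
def coneAddLine {n : ℕ} (V : Set (Fin n → ℝ)) : Set (Fin n → ℝ) :=
  {x | ∃ y ∈ coneOf V, ∃ μ : ℝ, x = y + μ • allOnes n}

/-- The comparability graph of a relation: an edge `{i, j}` for each pair `i ≠ j`
with `i ⪯ j` or `j ⪯ i`. -/
def compGraph {n : ℕ} (r : Fin n → Fin n → Prop) : SimpleGraph (Fin n) where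
  Adj i j := i ≠ j ∧ (r i j ∨ r j i)
  symm := ⟨fun i j h => ⟨h.1.symm, h.2.symm⟩⟩
  loopless := ⟨fun i h => h.1 rfl⟩

/-- The setoid on `Fin n` induced by a preposet: `i ∼ j` iff `i ⪯ j` and `j ⪯ i`. -/
def preSetoid {n : ℕ} (r : Fin n → Fin n → Prop)
    (hrefl : ∀ a, r a a) (htrans : ∀ a b c, r a b → r b c → r a c) : Setoid (Fin n) where
  r i j := r i j ∧ r j i
  iseqv := ⟨fun i => ⟨hrefl i, hrefl i⟩, fun h => ⟨h.2, h.1⟩,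
    fun h1 h2 => ⟨htrans _ _ _ h1.1 h2.1, htrans _ _ _ h2.2 h1.2⟩⟩

/-- The class of `j` covers the class of `i` in the partial order induced on
`∼`-equivalence classes by the preposet `r`. -/
def CoversCl {n : ℕ} (r : Fin n → Fin n → Prop) (i j : Fin n) : Prop :=
  r i j ∧ ¬ r j i ∧ ∀ c, r i c → r c j → (r c i ∨ r j c)

/-- The Hasse diagram of a preposet, as an undirected simple graph on the set of
`∼`-equivalence classes: an edge `{C, C'}` for each covering relation `C ⋖ C'`. -/
def hasseGraphQ {n : ℕ} (r : Fin n → Fin n → Prop)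
    (hrefl : ∀ a, r a a) (htrans : ∀ a b c, r a b → r b c → r a c) :
    SimpleGraph (Quotient (preSetoid r hrefl htrans)) where
  Adj C D := ∃ i j, Quotient.mk _ i = C ∧ Quotient.mk _ j = D ∧
    (CoversCl r i j ∨ CoversCl r j i)
  symm := by
    refine ⟨?_⟩
    rintro C D ⟨i, j, hi, hj, h⟩
    exact ⟨j, i, hj, hi, h.symm⟩
  loopless := by
    refine ⟨?_⟩
    rintro C ⟨i, j, hi, hj, h⟩
    have hij : r i j ∧ r j i := Quotient.exact (hi.trans hj.symm)
    rcases h with h | h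
    · exact h.2.1 hij.2
    · exact h.2.1 hij.1

/-- For a Hasse-diagram edge `[i] → [j]` of a preposet, the union of the equivalence
classes lying in the connected component of `[j]` after deleting the edge `{[i], [j]}`. -/
def compBQ {n : ℕ} (r : Fin n → Fin n → Prop)
    (hrefl : ∀ a, r a a) (htrans : ∀ a b c, r a b → r b c → r a c) (i j : Fin n) :
    Set (Fin n) :=
  {x | ((hasseGraphQ r hrefl htrans).deleteEdges
      {s(Quotient.mk (preSetoid r hrefl htrans) i, Quotient.mk (preSetoid r hrefl htrans) j)}).Reachable
      (Quotient.mk (preSetoid r hrefl htrans) j) (Quotient.mk (preSetoid r hrefl htrans) x)}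

/-- `A_i`: the connected component of `a i` in the Hasse diagram after deleting
all `k` edges `{a i, b}`. -/
def compA {n k : ℕ} (r : Fin n → Fin n → Prop) (a : Fin k → Fin n) (b : Fin n) (i : Fin k) :
    Set (Fin n) :=
  {x | ((hasseGraph r).deleteEdges {e | ∃ j, e = s(a j, b)}).Reachable (a i) x}

/-- The relation `E'` from the proof of the main theorem: all covering pairs `(i,j)` of `r`
with `j ≠ b`, the pair `(a i₀, b)`, and the pairs `(a m, a i₀)` for `m ≠ i₀`. -/
def newRel {n k : ℕ} (r : Fin n → Fin n → Prop) (a : Fin k → Fin n) (b : Fin n) (i₀ : Fin k) :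
    Fin n → Fin n → Prop :=
  fun i j => (CoversRel r i j ∧ j ≠ b) ∨ (i = a i₀ ∧ j = b) ∨
    (∃ m : Fin k, m ≠ i₀ ∧ i = a m ∧ j = a i₀)

end
theorem rayVec_diff {n : ℕ} {r : Fin n → Fin n → Prop} (h : IsTreePoset r)
    (p q : {p : Fin n × Fin n // CoversRel r p.1 p.2}) :
    rayVec r p.1.1 p.1.2 q.1.2 - rayVec r p.1.1 p.1.2 q.1.1 = if p = q then 1 else 0 := by
  classical
  obtain ⟨⟨a, b⟩, hp⟩ := p
  obtain ⟨⟨a', b'⟩, hq⟩ := q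
  obtain ⟨-, -, hanti, htree⟩ := h
  simp only at hp hq ⊢
  split_ifs with hpq
  · simp only [Subtype.mk.injEq, Prod.mk.injEq] at hpq
    obtain ⟨rfl, rfl⟩ := hpq
    have hb : b ∈ compB r a b := SimpleGraph.Reachable.refl _
    have ha : a ∉ compB r a b := by
      intro ha
      have hbr := SimpleGraph.isAcyclic_iff_forall_adj_isBridge.1 htree.2
        (show (hasseGraph r).Adj a b from Or.inl hp)
      rw [SimpleGraph.isBridge_iff] at hbr
      exact hbr (SimpleGraph.Reachable.symm ha)
    simp [rayVec, indVec, hb, ha]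
  · have hadj : ((hasseGraph r).deleteEdges {s(a, b)}).Adj a' b' := by
      rw [SimpleGraph.deleteEdges_adj]
      refine ⟨Or.inl hq, ?_⟩
      intro hs
      rw [Set.mem_singleton_iff, Sym2.eq_iff] at hs
      rcases hs with ⟨rfl, rfl⟩ | ⟨rfl, rfl⟩
      · exact hpq rfl
      · exact hp.2.1 (hanti _ _ hp.1 hq.1)
    have hiff : b' ∈ compB r a b ↔ a' ∈ compB r a b :=
      ⟨fun hh => SimpleGraph.Reachable.trans hh hadj.reachable.symm,
        fun hh => SimpleGraph.Reachable.trans hh hadj.reachable⟩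
    by_cases ha : a' ∈ compB r a b
    · simp [rayVec, indVec, ha, hiff.2 ha]
    · simp [rayVec, indVec, ha, mt hiff.1 ha]

theorem const_of_covers {n : ℕ} {r : Fin n → Fin n → Prop} (h : IsTreePoset r)
    (y : Fin n → ℝ) (hy : ∀ a b, CoversRel r a b → y b = y a) (i j : Fin n) : y i = y j := by
  obtain ⟨w⟩ := h.2.2.2.1.preconnected i j
  induction w with
  | nil => rfl
  | cons hadj _ ih =>
    rw [← ih]
    rcases hadj with hh | hh
    · exact (hy _ _ hh).symm
    · exact hy _ _ hh

/-- For a tree poset `⪯` on `Fin n`, the vectors `v_{a→b}` over the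
covering relations `a ⋖ b`, together with the all-ones vector `e`, form a `ℤ`-basis of
`ℤ^n`: they are linearly independent over `ℝ` and every integer vector is an integer
linear combination of them. -/
theorem rayVecs_with_allOnes_integer_basis (n : ℕ) (hn : 1 ≤ n)
    (r : Fin n → Fin n → Prop) (hposet : IsTreePoset r) :
    LinearIndependent ℝ
      (fun p : Option {p : Fin n × Fin n // CoversRel r p.1 p.2} =>
        p.elim (allOnes n) fun q => rayVec r q.1.1 q.1.2) ∧
    ∀ x : Fin n → ℤ, ∃ c : Option {p : Fin n × Fin n // CoversRel r p.1 p.2} → ℤ,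
      (fun i => (x i : ℝ)) =
        ∑ᶠ p, (c p : ℝ) • p.elim (allOnes n) fun q => rayVec r q.1.1 q.1.2 := by
  classical
  have hdiff : ∀ (c : Option {p : Fin n × Fin n // CoversRel r p.1 p.2} → ℝ)
      (q : {p : Fin n × Fin n // CoversRel r p.1 p.2}),
      (∑ p, c p • (p.elim (allOnes n) fun q => rayVec r q.1.1 q.1.2)) q.1.2 -
      (∑ p, c p • (p.elim (allOnes n) fun q => rayVec r q.1.1 q.1.2)) q.1.1 = c (some q) := by
    intro c q
    have e : ∀ p : {p : Fin n × Fin n // CoversRel r p.1 p.2},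
        c (some p) * rayVec r p.1.1 p.1.2 q.1.2 - c (some p) * rayVec r p.1.1 p.1.2 q.1.1 =
          if p = q then c (some p) else 0 := by
      intro p
      rw [← mul_sub, rayVec_diff hposet p q]
      simp
    rw [Finset.sum_apply, Finset.sum_apply, Fintype.sum_option, Fintype.sum_option]
    simp only [Pi.smul_apply, smul_eq_mul, Option.elim, allOnes]
    rw [add_sub_add_left_eq_sub, ← Finset.sum_sub_distrib]
    simp [e]
  have i0 : Fin n := ⟨0, hn⟩
  constructor
  · rw [Fintype.linearIndependent_iff]
    intro c hc
    have hs : ∀ q, c (some q) = 0 := by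
      intro q
      rw [← hdiff c q, hc]
      simp
    rintro (_ | q)
    · have := congrFun hc i0
      rw [Finset.sum_apply, Fintype.sum_option] at this
      simpa [hs, allOnes] using this
    · exact hs q
  · intro x
    let S : ℤ := ∑ q : {p : Fin n × Fin n // CoversRel r p.1 p.2},
      (x q.1.2 - x q.1.1) * (if i0 ∈ compB r q.1.1 q.1.2 then 1 else 0)
    let c : Option {p : Fin n × Fin n // CoversRel r p.1 p.2} → ℤ :=
      fun p => p.elim (x i0 - S) fun q => x q.1.2 - x q.1.1
    refine ⟨c, ?_⟩
    rw [finsum_eq_sum_of_fintype]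
    have h0 : (∑ p, (c p : ℝ) • (p.elim (allOnes n) fun q => rayVec r q.1.1 q.1.2)) i0
        = x i0 := by
      rw [Finset.sum_apply, Fintype.sum_option]
      simp [c, S, allOnes, rayVec, indVec, Set.indicator_apply]
    funext i
    have := const_of_covers hposet
      (fun i => (x i : ℝ) -
        (∑ p, (c p : ℝ) • (p.elim (allOnes n) fun q => rayVec r q.1.1 q.1.2)) i)
      (fun a b hab => by
        have := hdiff (fun p => (c p : ℝ)) ⟨(a, b), hab⟩
        simp only [c, Option.elim] at this ⊢
        push_cast at this ⊢
        linarith) i i0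
    simp only [h0, sub_self] at this
    linarith
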